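/- Let $t \ge 2$ be an even integer and $p$ a prime with $p - 1 = a(t-1)$ and $a$ even, and let $g$ be a primitive root of $\mathbb{F}_p$. Suppose $f \in \mathbb{F}_p^*$ is written as $f = g^{ca+d}$ with $c \in \{1,\dots,t-1\}$ and $d \in \{1,\dots,a\}$, and suppose $a/2 + 1 \le d \le a$. Then $P_f = \{(w,b) \in W \times B : g^w b = f\}$ is empty, and $N_f = \{(w,b) \in W \times B : g^w b = -f\}$ consists of exactly one pair, namely $\left(ca + \tfrac{ta}{2},\; g^{d - a/2}\right)$ if $c \le \tfrac{t}{2} - 1$, and $\left(ca - \tfrac{ta}{2} + a,\; g^{d - a/2}\right)$ if $c \ge \tfrac{t}{2}$, where $B = \{g, g^2, \dots, g^{a/2}\}$ and $W = \{a, 2a, \dots, (t-1)a\}$. -/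

import Mathlib

theorem Nat.ModEq.eq_of_mem_Icc_one {m x y : ℕ} (h : x ≡ y [MOD m])
    (hx1 : 1 ≤ x) (hx : x ≤ m) (hy1 : 1 ≤ y) (hy : y ≤ m) : x = y := by
  obtain ⟨x, rfl⟩ := Nat.exists_eq_add_of_le' hx1
  obtain ⟨y, rfl⟩ := Nat.exists_eq_add_of_le' hy1
  rw [(Nat.ModEq.add_right_cancel' 1 h).eq_of_lt_of_lt hx hy]

/-- Exponents `j * a + i` with `1 ≤ j ≤ m` and `1 ≤ i ≤ a` give distinct powers of a primitive
`a * m`-th root of unity. -/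
theorem IsPrimitiveRoot.pow_mul_add_inj {M : Type*} [CommMonoid M] {g : M} {a m : ℕ}
    (hg : IsPrimitiveRoot g (a * m)) {j k i l : ℕ}
    (hj1 : 1 ≤ j) (hj : j ≤ m) (hk1 : 1 ≤ k) (hk : k ≤ m)
    (hi1 : 1 ≤ i) (hi : i ≤ a) (hl1 : 1 ≤ l) (hl : l ≤ a)
    (h : g ^ (j * a + i) = g ^ (k * a + l)) : j = k ∧ i = l := by
  have ha : 0 < a := by omega
  have hm : 0 < m := by omega
  have hfin : IsOfFinOrder g :=
    isOfFinOrder_iff_pow_eq_one.2 ⟨a * m, Nat.mul_pos ha hm, hg.pow_eq_one⟩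
  rw [hfin.pow_eq_pow_iff_modEq, ← hg.eq_orderOf] at h
  have hil : i = l := by
    refine Nat.ModEq.eq_of_mem_Icc_one (m := a) ?_ hi1 hi hl1 hl
    simpa [Nat.ModEq] using h.of_mul_right m
  subst hil
  refine ⟨Nat.ModEq.eq_of_mem_Icc_one (m := m) ?_ hj1 hj hk1 hk, rfl⟩
  have h' := Nat.ModEq.add_right_cancel' i h
  rw [mul_comm j, mul_comm k] at h'
  exact Nat.ModEq.mul_left_cancel' ha.ne' h'

/-- A primitive root of unity of even order `2 * n` has `n`-th power `-1`. -/
theorem IsPrimitiveRoot.pow_half_eq_neg_one {R : Type*} [CommRing R] [IsDomain R] {g : R} {n : ℕ}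
    (hn : 0 < n) (hg : IsPrimitiveRoot g (2 * n)) : g ^ n = -1 :=
  (hg.pow (by omega) (mul_comm 2 n)).eq_neg_one_of_two_right

/-- Let `t ≥ 2` be even, `p` prime with `p - 1 = a(t-1)` and `a` even,
`g` a primitive root of `𝔽_p`, `B = {g, …, g^{a/2}}`, `W = {a, 2a, …, (t-1)a}`.
If `f = g^{ca+d}` with `1 ≤ c ≤ t-1`, `a/2 + 1 ≤ d ≤ a`, then `P_f = ∅` and `N_f`
consists of exactly one pair: `(ca + ta/2, g^{d-a/2})` if `c ≤ t/2 - 1`, and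
`(ca - ta/2 + a, g^{d-a/2})` if `c ≥ t/2`. -/
theorem stmt_5 (t a p : ℕ) (ht : 2 ≤ t) (hteven : Even t) (hp : p.Prime)
    (hpa : p - 1 = a * (t - 1)) (ha : Even a)
    (g : ZMod p) (hg : IsPrimitiveRoot g (p - 1))
    (W : Set ℕ) (hW : W = {w | ∃ j, 1 ≤ j ∧ j ≤ t - 1 ∧ w = j * a})
    (B : Set (ZMod p)) (hB : B = {b | ∃ i, 1 ≤ i ∧ i ≤ a / 2 ∧ b = g ^ i})
    (c d : ℕ) (hc1 : 1 ≤ c) (hc2 : c ≤ t - 1) (hd1 : a / 2 + 1 ≤ d) (hd2 : d ≤ a)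
    (f : ZMod p) (hf : f = g ^ (c * a + d))
    (Pf Nf : Set (ℕ × ZMod p))
    (hPf : Pf = {wb | wb.1 ∈ W ∧ wb.2 ∈ B ∧ g ^ wb.1 * wb.2 = f})
    (hNf : Nf = {wb | wb.1 ∈ W ∧ wb.2 ∈ B ∧ g ^ wb.1 * wb.2 = -f}) :
    Pf = ∅ ∧
    (c ≤ t / 2 - 1 → Nf = {(c * a + t * a / 2, g ^ (d - a / 2))}) ∧
    (t / 2 ≤ c → Nf = {(c * a - t * a / 2 + a, g ^ (d - a / 2))}) := by
  have : Fact p.Prime := ⟨hp⟩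
  obtain ⟨s, rfl⟩ := hteven
  obtain ⟨r, rfl⟩ := ha
  rw [hpa] at hg
  have hr : (r + r) / 2 = r := by omega
  have hs : (s + s) / 2 = s := by omega
  have hsr : (s + s) * (r + r) / 2 = s * (r + r) := by
    rw [← two_mul s, mul_assoc, Nat.mul_div_cancel_left _ two_pos]
  rw [hr] at hB hd1
  rw [hr, hs, hsr]
  subst hW hB hf
  have hneg : g ^ (r * (s + s - 1)) = -1 := by
    refine IsPrimitiveRoot.pow_half_eq_neg_one (Nat.mul_pos (by omega) (by omega)) ?_
    rwa [← mul_assoc, two_mul]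
  have hnegf : -g ^ (c * (r + r) + d) = g ^ ((c + s) * (r + r) + (d - r)) := by
    rw [neg_eq_neg_one_mul, ← hneg, ← pow_add]
    congr 1
    obtain ⟨e, rfl⟩ := Nat.exists_eq_add_of_le (show r ≤ d by omega)
    obtain ⟨u, rfl⟩ := Nat.exists_eq_add_of_le' (show 1 ≤ s by omega)
    rw [show u + 1 + (u + 1) - 1 = 2 * u + 1 by omega, Nat.add_sub_cancel_left]
    ring
  have hNf_eq : ∀ k, 1 ≤ k → k ≤ s + s - 1 →
      -g ^ (c * (r + r) + d) = g ^ (k * (r + r) + (d - r)) →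
      Nf = {(k * (r + r), g ^ (d - r))} := by
    intro k hk1 hk hfk
    rw [hNf, hfk]
    ext ⟨w, b⟩
    simp only [Set.mem_ofPred_eq, Set.mem_singleton_iff, Prod.mk.injEq]
    constructor
    · rintro ⟨⟨j, hj1, hj, rfl⟩, ⟨i, hi1, hi, rfl⟩, h⟩
      rw [← pow_add] at h
      obtain ⟨rfl, rfl⟩ := hg.pow_mul_add_inj hj1 hj hk1 hk hi1 (by omega) (by omega) (by omega) h
      exact ⟨rfl, rfl⟩
    · rintro ⟨rfl, rfl⟩
      exact ⟨⟨k, hk1, hk, rfl⟩, ⟨d - r, by omega, by omega, rfl⟩, (pow_add _ _ _).symm⟩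
  refine ⟨?_, fun hc => ?_, fun hc => ?_⟩
  · rw [hPf, Set.eq_empty_iff_forall_notMem]
    rintro ⟨w, b⟩ ⟨⟨j, hj1, hj, hw⟩, ⟨i, hi1, hi, hb⟩, h⟩
    dsimp only at hw hb h
    rw [hw, hb, ← pow_add] at h
    have := (hg.pow_mul_add_inj hj1 hj hc1 hc2 hi1 (by omega) (by omega) hd2 h).2
    omega
  · rw [← add_mul]
    exact hNf_eq (c + s) (by omega) (by omega) hnegf
  · rw [← Nat.sub_mul, ← Nat.succ_mul]
    refine hNf_eq (c - s + 1) (by omega) (by omega) ?_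
    have hexp : (c + s) * (r + r) + (d - r) =
        (r + r) * (s + s - 1) + ((c - s + 1) * (r + r) + (d - r)) := by
      rw [← add_assoc, mul_comm (r + r) (s + s - 1), ← add_mul,
        show s + s - 1 + (c - s + 1) = c + s by omega]
    rw [hnegf, hexp, pow_add, hg.pow_eq_one, one_mul]
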